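/- Assume Ω satisfies SR-propagation, the noiseless observed values T̂_α are nonzero for all α ∈ Ω, and T ∈ ℝ^⟦N⟧ is the unique rank-one completion with matrix 𝐗̄. Let Q̄ ∈ 𝕊^{N+1} be a rank-N Gram matrix certifying tightness of (SDP-E) (i.e. the Gram matrix from the SOS identity Σ_β(x_β² − T_β²) = σ mod (I_2+J_2)). Then there exists a constant K > 0 such that for every noise vector ε ∈ ℝ^Ω and every sufficiently large C > 0, there is a matrix Q̄_c^ε that is feasible for the dual (dSDP-N) of the noisy relaxation (SDP-N) and satisfies: Q̄_c^ε ⪰ Q̄, Q̄_c^ε • 𝐗̄ ≤ K(‖ε‖_∞ + ‖ε‖_∞²·C + 1/C), and Q̄_c^ε • 𝐗_c^ε ≤ K(‖ε‖_∞ + ‖ε‖_∞²·C + 1/C) for every optimal solution 𝐗_c^ε of (SDP-N). -/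

import Mathlib

namespace RankOneTC

open scoped BigOperators
open MeasureTheory

/-- The index set `⟦N⟧ = [n 0] × ⋯ × [n (d-1)]`. -/
abbrev Idx {d : ℕ} (n : Fin d → ℕ) : Type := ∀ i : Fin d, Fin (n i)

/-- A tensor is rank one if it is an outer product of `d` vectors. -/
def IsRankOne {d : ℕ} {n : Fin d → ℕ} (T : Idx n → ℝ) : Prop :=
  ∃ u : ∀ i : Fin d, Fin (n i) → ℝ, ∀ α : Idx n, T α = ∏ i : Fin d, u i (α i)

/-- `Ω` satisfies unique recovery: for any nonzero observed values, the rank-one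
completion problem is infeasible or has exactly one solution. -/
def UniqueRecovery {d : ℕ} {n : Fin d → ℕ} (Ω : Set (Idx n)) : Prop :=
  ∀ That : Idx n → ℝ, (∀ α ∈ Ω, That α ≠ 0) →
    {T : Idx n → ℝ | IsRankOne T ∧ ∀ α ∈ Ω, T α = That α}.Subsingleton

/-- The 𝔽₂ vector `v_α`, the concatenation of indicator vectors of the coordinates. -/
def vF2 {d : ℕ} {n : Fin d → ℕ} (α : Idx n) : (Σ i : Fin d, Fin (n i)) → ZMod 2 :=
  fun s => if α s.1 = s.2 then 1 else 0

/-- A generalized square: four distinct tuples whose `v`-vectors sum to zero over 𝔽₂. -/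
def IsGenSquare {d : ℕ} {n : Fin d → ℕ} (α₁ α₂ α₃ α₄ : Idx n) : Prop :=
  [α₁, α₂, α₃, α₄].Nodup ∧ vF2 α₁ + vF2 α₂ + vF2 α₃ + vF2 α₄ = 0

/-- A square `{α₁,α₂;α₃,α₄}`: four distinct tuples with coordinatewise equal max and min
of the two opposite pairs. -/
def IsSquare {d : ℕ} {n : Fin d → ℕ} (α₁ α₂ α₃ α₄ : Idx n) : Prop :=
  [α₁, α₂, α₃, α₄].Nodup ∧
    ∀ k : Fin d, max (α₁ k) (α₂ k) = max (α₃ k) (α₄ k) ∧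
      min (α₁ k) (α₂ k) = min (α₃ k) (α₄ k)

/-- The GS-propagated set `𝒫_GS(Ω)` as an inductive predicate. -/
inductive PGS {d : ℕ} {n : Fin d → ℕ} (Ω : Set (Idx n)) : Idx n → Prop
  | base {α : Idx n} : α ∈ Ω → PGS Ω α
  | prop {α₁ α₂ α₃ β : Idx n} : IsGenSquare α₁ α₂ α₃ β →
      PGS Ω α₁ → PGS Ω α₂ → PGS Ω α₃ → PGS Ω β

def GSPropagation {d : ℕ} {n : Fin d → ℕ} (Ω : Set (Idx n)) : Prop :=
  ∀ β : Idx n, PGS Ω β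

/-- The S-propagated set `𝒫_S(Ω)` as an inductive predicate. -/
inductive PS {d : ℕ} {n : Fin d → ℕ} (Ω : Set (Idx n)) : Idx n → Prop
  | base {α : Idx n} : α ∈ Ω → PS Ω α
  | prop {α₁ α₂ α₃ β : Idx n} : IsSquare α₁ α₂ α₃ β →
      PS Ω α₁ → PS Ω α₂ → PS Ω α₃ → PS Ω β

def SPropagation {d : ℕ} {n : Fin d → ℕ} (Ω : Set (Idx n)) : Prop :=
  ∀ β : Idx n, PS Ω β

/-- The SR-propagated set `𝒫_SR(Ω)` as an inductive predicate. -/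
inductive PSR {d : ℕ} {n : Fin d → ℕ} (Ω : Set (Idx n)) : Idx n → Prop
  | base {α : Idx n} : α ∈ Ω → PSR Ω α
  | prop {α₁ β α₂ γ : Idx n} : IsSquare α₁ β α₂ γ →
      α₁ ∈ Ω → α₂ ∈ Ω → PSR Ω β → PSR Ω γ

def SRPropagation {d : ℕ} {n : Fin d → ℕ} (Ω : Set (Idx n)) : Prop :=
  ∀ β : Idx n, PSR Ω β

/-- A sequence is strongly connected if each later element agrees with some earlier
element in exactly `d - 1` coordinates. -/
def StronglyConnected {d : ℕ} {n : Fin d → ℕ} {p : ℕ} (α : Fin p → Idx n) : Prop :=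
  ∀ k : Fin p, 0 < (k : ℕ) → ∃ i : Fin p, i < k ∧
    (Finset.univ.filter fun j : Fin d => α k j = α i j).card = d - 1

/-- A-propagation: a strongly connected sequence of elements of `Ω` covering all
coordinates. -/
def APropagation {d : ℕ} {n : Fin d → ℕ} (Ω : Set (Idx n)) : Prop :=
  ∃ (p : ℕ) (α : Fin p → Idx n), (∀ k, α k ∈ Ω) ∧ StronglyConnected α ∧
    ∀ (i : Fin d) (j : Fin (n i)), ∃ k : Fin p, α k i = j

/-- The 𝔽₂ matrix `V_Ω` whose rows are the vectors `v_α`, `α ∈ Ω`. -/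
def maskMatrix {d : ℕ} {n : Fin d → ℕ} (Ω : Finset (Idx n)) :
    Matrix {α : Idx n // α ∈ Ω} (Σ i : Fin d, Fin (n i)) (ZMod 2) :=
  Matrix.of fun α s => vF2 α.1 s

/-! ### SDP formulations -/

/-- The bordered matrix `𝐗 = [[1, xᵀ],[x, X]]`, indexed by `Option (Idx n)` where
`none` is the extra index. -/
def border {d : ℕ} {n : Fin d → ℕ} (x : Idx n → ℝ) (X : Matrix (Idx n) (Idx n) ℝ) :
    Matrix (Option (Idx n)) (Option (Idx n)) ℝ :=
  Matrix.of fun a b =>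
    match a, b with
    | Option.none, Option.none => (1 : ℝ)
    | Option.none, Option.some β => x β
    | Option.some α, Option.none => x α
    | Option.some α, Option.some β => X α β

/-- Feasibility for the exact SDP relaxation (SDP-E). -/
structure SDPEFeasible {d : ℕ} {n : Fin d → ℕ} (Ω : Set (Idx n)) (That : Idx n → ℝ)
    (x : Idx n → ℝ) (X : Matrix (Idx n) (Idx n) ℝ) : Prop where
  isSymm : X.IsSymm
  obs : ∀ α ∈ Ω, x α = That α
  obsDiag : ∀ α ∈ Ω, X α α = That α ^ 2
  squares : ∀ α₁ α₂ α₃ α₄ : Idx n, IsSquare α₁ α₂ α₃ α₄ → X α₁ α₂ = X α₃ α₄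
  psd : (border x X).PosSemidef

/-- Tightness of (SDP-E): the matrix `𝐗̄` built from the completion `T` is feasible and
is the unique minimizer of the trace objective. -/
def SDPETight {d : ℕ} {n : Fin d → ℕ} (Ω : Set (Idx n)) (That T : Idx n → ℝ) : Prop :=
  SDPEFeasible Ω That T (Matrix.vecMulVec T T) ∧
  ∀ x X, SDPEFeasible Ω That x X →
    Matrix.trace (Matrix.vecMulVec T T) ≤ Matrix.trace X ∧
    (Matrix.trace X = Matrix.trace (Matrix.vecMulVec T T) →
      x = T ∧ X = Matrix.vecMulVec T T)

/-- Tightness of the weighted relaxation (SDP-Eʷ) with weights `w`. -/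
def SDPEwTight {d : ℕ} {n : Fin d → ℕ} (Ω : Set (Idx n)) (w : Idx n → ℝ)
    (That T : Idx n → ℝ) : Prop :=
  SDPEFeasible Ω That T (Matrix.vecMulVec T T) ∧
  ∀ x X, SDPEFeasible Ω That x X →
    (∑ β : Idx n, w β * Matrix.vecMulVec T T β β) ≤ (∑ β : Idx n, w β * X β β) ∧
    ((∑ β : Idx n, w β * X β β) = (∑ β : Idx n, w β * Matrix.vecMulVec T T β β) →
      x = T ∧ X = Matrix.vecMulVec T T)

/-- Feasibility for the noisy SDP relaxation (SDP-N). -/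
structure SDPNFeasible {d : ℕ} {n : Fin d → ℕ}
    (x : Idx n → ℝ) (X : Matrix (Idx n) (Idx n) ℝ) : Prop where
  isSymm : X.IsSymm
  squares : ∀ α₁ α₂ α₃ α₄ : Idx n, IsSquare α₁ α₂ α₃ α₄ → X α₁ α₂ = X α₃ α₄
  psd : (border x X).PosSemidef

/-- Objective of (SDP-N) with noisy data `Teps` and penalty constant `c`. -/
noncomputable def sdpnObj {d : ℕ} {n : Fin d → ℕ} (Ω : Finset (Idx n))
    (Teps : Idx n → ℝ) (c : ℝ) (x : Idx n → ℝ) (X : Matrix (Idx n) (Idx n) ℝ) : ℝ :=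
  Matrix.trace X + c * ∑ α ∈ Ω, (X α α - 2 * Teps α * x α + Teps α ^ 2)

/-- Optimality for (SDP-N). -/
def SDPNOptimal {d : ℕ} {n : Fin d → ℕ} (Ω : Finset (Idx n)) (Teps : Idx n → ℝ)
    (c : ℝ) (x : Idx n → ℝ) (X : Matrix (Idx n) (Idx n) ℝ) : Prop :=
  SDPNFeasible x X ∧
    ∀ y Y, SDPNFeasible y Y → sdpnObj Ω Teps c x X ≤ sdpnObj Ω Teps c y Y

/-- Frobenius norm of a square real matrix. -/
noncomputable def frob {m : Type*} [Fintype m] (A : Matrix m m ℝ) : ℝ :=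
  Real.sqrt (∑ a : m, ∑ b : m, A a b ^ 2)

/-- `‖ε‖_∞ = max_{α ∈ Ω} |ε α|`. -/
noncomputable def supNormOn {d : ℕ} {n : Fin d → ℕ} (Ω : Finset (Idx n))
    (ε : Idx n → ℝ) : ℝ :=
  ⨆ α : {a : Idx n // a ∈ Ω}, |ε (α : Idx n)|

/-- The function `χ(s) = s + √s`. -/
noncomputable def chiFn (s : ℝ) : ℝ := s + Real.sqrt s

/-! ### Polynomial (sum of squares) machinery -/

/-- `f_α = x_α - T̂_α`. -/
noncomputable def fPoly {d : ℕ} {n : Fin d → ℕ} (That : Idx n → ℝ) (α : Idx n) :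
    MvPolynomial (Idx n) ℝ :=
  MvPolynomial.X α - MvPolynomial.C (That α)

/-- `g_α = x_α² - T̂_α²`. -/
noncomputable def gPoly {d : ℕ} {n : Fin d → ℕ} (That : Idx n → ℝ) (α : Idx n) :
    MvPolynomial (Idx n) ℝ :=
  MvPolynomial.X α ^ 2 - MvPolynomial.C (That α ^ 2)

/-- Sums of squares of polynomials. -/
def IsSOS {d : ℕ} {n : Fin d → ℕ} (p : MvPolynomial (Idx n) ℝ) : Prop :=
  ∃ (k : ℕ) (q : Fin k → MvPolynomial (Idx n) ℝ), p = ∑ i : Fin k, q i ^ 2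

/-- `Σ_{N,2}`: sums of squares of degree at most 2. -/
def SigmaN2 {d : ℕ} {n : Fin d → ℕ} (p : MvPolynomial (Idx n) ℝ) : Prop :=
  IsSOS p ∧ p.totalDegree ≤ 2

/-- The truncated ideal `I₂`, the span of the `f_α` and `g_α` for `α ∈ Ω`. -/
noncomputable def I2span {d : ℕ} {n : Fin d → ℕ} (Ω : Set (Idx n)) (That : Idx n → ℝ) :
    Submodule ℝ (MvPolynomial (Idx n) ℝ) :=
  Submodule.span ℝ
    ({p | ∃ α ∈ Ω, p = fPoly That α} ∪ {p | ∃ α ∈ Ω, p = gPoly That α})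

/-- The truncated ideal `J₂`, the span of the square relations. -/
noncomputable def J2span {d : ℕ} (n : Fin d → ℕ) : Submodule ℝ (MvPolynomial (Idx n) ℝ) :=
  Submodule.span ℝ
    {p | ∃ a b c e : Idx n, IsSquare a b c e ∧
      p = MvPolynomial.X a * MvPolynomial.X b - MvPolynomial.X c * MvPolynomial.X e}

/-- The quadratic polynomial `[1;x]ᵀ Q [1;x]` associated to a matrix `Q ∈ 𝕊^{N+1}`. -/
noncomputable def gramPoly {d : ℕ} {n : Fin d → ℕ}
    (Q : Matrix (Option (Idx n)) (Option (Idx n)) ℝ) : MvPolynomial (Idx n) ℝ :=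
  ∑ a : Option (Idx n), ∑ b : Option (Idx n),
    MvPolynomial.C (Q a b) * (Option.elim a 1 MvPolynomial.X) *
      (Option.elim b 1 MvPolynomial.X)

/-! ### Dual of the noisy SDP -/

/-- The trace inner product `A • B` of two matrices. -/
noncomputable def dotM {m : Type*} [Fintype m] (A B : Matrix m m ℝ) : ℝ :=
  ∑ a : m, ∑ b : m, A a b * B a b

/-- The indicator vector `e_α`, padded with a zero at the extra index. -/
def indVec {d : ℕ} {n : Fin d → ℕ} (α : Idx n) : Option (Idx n) → ℝ :=
  fun o => if o = some α then 1 else 0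

/-- The matrix `A_α = [-T^ε_α; e_α][-T^ε_α; e_α]ᵀ`. -/
noncomputable def Amat {d : ℕ} {n : Fin d → ℕ} (Teps : Idx n → ℝ) (α : Idx n) :
    Matrix (Option (Idx n)) (Option (Idx n)) ℝ :=
  Matrix.vecMulVec (fun o => Option.elim o (-Teps α) (fun β => if β = α then 1 else 0))
    (fun o => Option.elim o (-Teps α) (fun β => if β = α then 1 else 0))

/-- The (padded) matrix `E_{α,β} = e_α e_βᵀ + e_β e_αᵀ`. -/
noncomputable def Ebig {d : ℕ} {n : Fin d → ℕ} (a b : Idx n) :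
    Matrix (Option (Idx n)) (Option (Idx n)) ℝ :=
  Matrix.vecMulVec (indVec a) (indVec b) + Matrix.vecMulVec (indVec b) (indVec a)

/-- The matrix `[[1,0],[0,0]]`. -/
def E00 {d : ℕ} {n : Fin d → ℕ} : Matrix (Option (Idx n)) (Option (Idx n)) ℝ :=
  Matrix.of fun a b => if a = none ∧ b = none then 1 else 0

/-- The matrix `[[0,0],[0,I_N]]`. -/
def Ibot {d : ℕ} {n : Fin d → ℕ} : Matrix (Option (Idx n)) (Option (Idx n)) ℝ :=
  1 - E00

open Classical in
/-- The dual slack matrix of (dSDP-N) associated to data `(ρ, μ)`. -/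
noncomputable def dualNMatrix {d : ℕ} {n : Fin d → ℕ} (Ω : Finset (Idx n))
    (Teps : Idx n → ℝ) (c ρ : ℝ) (μ : Idx n → Idx n → Idx n → Idx n → ℝ) :
    Matrix (Option (Idx n)) (Option (Idx n)) ℝ :=
  Ibot - ρ • E00 + c • (∑ α ∈ Ω, Amat Teps α) -
    ∑ a : Idx n, ∑ b : Idx n, ∑ cc : Idx n, ∑ e : Idx n,
      (if IsSquare a b cc e then (μ a b cc e / 2) • (Ebig a b - Ebig cc e) else 0)

/-- Dual feasibility for (dSDP-N): `Q` is PSD and has the prescribed dual form. -/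
def DualNFeasible {d : ℕ} {n : Fin d → ℕ} (Ω : Finset (Idx n)) (Teps : Idx n → ℝ)
    (c : ℝ) (Q : Matrix (Option (Idx n)) (Option (Idx n)) ℝ) : Prop :=
  Q.PosSemidef ∧ ∃ (ρ : ℝ) (μ : Idx n → Idx n → Idx n → Idx n → ℝ),
    Q = dualNMatrix Ω Teps c ρ μ

/-! ### Level-based weights (Algorithm 1) -/

/-- Cumulative level sets: level 0 is `𝒫_SR(Ω)`; each next level adds the tuples
completing a square with three previously reached tuples. -/
def srLevelSet {d : ℕ} {n : Fin d → ℕ} (Ω : Set (Idx n)) : ℕ → Set (Idx n)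
  | 0 => {β | PSR Ω β}
  | (ℓ + 1) => srLevelSet Ω ℓ ∪ {β | ∃ a b c : Idx n,
      a ∈ srLevelSet Ω ℓ ∧ b ∈ srLevelSet Ω ℓ ∧ c ∈ srLevelSet Ω ℓ ∧ IsSquare a b c β}

/-- The level-based weight vector `w(ϑ)`: `w(ϑ)_β = ϑ^ℓ` where `ℓ` is the first level
containing `β`. -/
noncomputable def levelWeight {d : ℕ} {n : Fin d → ℕ} (Ω : Set (Idx n)) (θ : ℝ)
    (β : Idx n) : ℝ :=
  θ ^ sInf {ℓ : ℕ | β ∈ srLevelSet Ω ℓ}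

/-! ### Random masks -/

/-- The Bernoulli measure on `Bool` with success probability `p`. -/
noncomputable def bern (p : ℝ) : Measure Bool :=
  (ENNReal.ofReal p) • Measure.dirac true + (ENNReal.ofReal (1 - p)) • Measure.dirac false


section TraceInner

variable {m : Type*} [Fintype m]

theorem dotM_eq_trace (A B : Matrix m m ℝ) : dotM A B = Matrix.trace (A * B.transpose) := by
  simp [dotM, Matrix.trace, Matrix.mul_apply]

theorem dotM_add (A B X : Matrix m m ℝ) : dotM (A + B) X = dotM A X + dotM B X := by
  simp [dotM_eq_trace, Matrix.add_mul]

theorem dotM_sub (A B X : Matrix m m ℝ) : dotM (A - B) X = dotM A X - dotM B X := by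
  simp [dotM_eq_trace, Matrix.sub_mul]

theorem dotM_smul (r : ℝ) (A X : Matrix m m ℝ) : dotM (r • A) X = r * dotM A X := by
  simp [dotM_eq_trace]

theorem dotM_zero (X : Matrix m m ℝ) : dotM 0 X = 0 := by
  simp [dotM_eq_trace]

theorem dotM_sum {ι : Type*} (s : Finset ι) (A : ι → Matrix m m ℝ) (X : Matrix m m ℝ) :
    dotM (∑ i ∈ s, A i) X = ∑ i ∈ s, dotM (A i) X := by
  simp [dotM_eq_trace, Matrix.sum_mul, Matrix.trace_sum]

theorem dotM_vecMulVec_left (u v : m → ℝ) (X : Matrix m m ℝ) :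
    dotM (Matrix.vecMulVec u v) X = ∑ a, ∑ b, u a * v b * X a b := by
  simp [dotM, Matrix.vecMulVec_apply]

end TraceInner

section DualMatrix

variable {d : ℕ} {n : Fin d → ℕ}

theorem border_vecMulVec_self (x : Idx n → ℝ) :
    border x (Matrix.vecMulVec x x) =
      Matrix.vecMulVec (fun o => Option.elim o 1 x) (fun o => Option.elim o 1 x) := by
  ext a b
  rcases a with _ | a <;> rcases b with _ | b <;>
    simp [border, Matrix.vecMulVec_apply]

theorem dotM_border_vecMulVec_self (Q : Matrix (Option (Idx n)) (Option (Idx n)) ℝ)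
    (x : Idx n → ℝ) :
    dotM Q (border x (Matrix.vecMulVec x x)) = MvPolynomial.eval x (gramPoly Q) := by
  simp only [border_vecMulVec_self, dotM, gramPoly, map_sum, map_mul, MvPolynomial.eval_C,
    Matrix.vecMulVec_apply]
  refine Finset.sum_congr rfl fun a _ => Finset.sum_congr rfl fun b _ => ?_
  rcases a with _ | a <;> rcases b with _ | b <;> simp [mul_assoc]

theorem dotM_E00 (x : Idx n → ℝ) (X : Matrix (Idx n) (Idx n) ℝ) :
    dotM (E00 (n := n)) (border x X) = 1 := by
  simp [dotM, E00, border, Fintype.sum_option]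

theorem dotM_Ibot (x : Idx n → ℝ) (X : Matrix (Idx n) (Idx n) ℝ) :
    dotM (Ibot (n := n)) (border x X) = Matrix.trace X := by
  rw [Ibot, dotM_sub, dotM_E00]
  simp [dotM, border, Matrix.one_apply, Fintype.sum_option, Matrix.trace]

theorem dotM_Amat (Teps : Idx n → ℝ) (α : Idx n) (x : Idx n → ℝ)
    (X : Matrix (Idx n) (Idx n) ℝ) :
    dotM (Amat Teps α) (border x X) = X α α - 2 * Teps α * x α + Teps α ^ 2 := by
  rw [Amat, dotM_vecMulVec_left]
  simp [border, Fintype.sum_option, Finset.sum_add_distrib]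
  ring

theorem dotM_Ebig (a b : Idx n) (x : Idx n → ℝ) (X : Matrix (Idx n) (Idx n) ℝ) :
    dotM (Ebig a b) (border x X) = X a b + X b a := by
  rw [Ebig, dotM_add, dotM_vecMulVec_left, dotM_vecMulVec_left]
  simp [border, indVec]

open Classical in
theorem dotM_dualNMatrix (Ω : Finset (Idx n)) (Teps : Idx n → ℝ) (c ρ : ℝ)
    (μ : Idx n → Idx n → Idx n → Idx n → ℝ) (x : Idx n → ℝ) (X : Matrix (Idx n) (Idx n) ℝ) :
    dotM (dualNMatrix Ω Teps c ρ μ) (border x X) =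
      sdpnObj Ω Teps c x X - ρ -
        ∑ a : Idx n, ∑ b : Idx n, ∑ cc : Idx n, ∑ e : Idx n,
          (if IsSquare a b cc e then
            (μ a b cc e / 2) * ((X a b + X b a) - (X cc e + X e cc)) else 0) := by
  simp only [dualNMatrix, dotM_sub, dotM_add, dotM_smul, dotM_sum, dotM_Ibot, dotM_E00,
    dotM_Amat, apply_ite (fun M => dotM M (border x X)), dotM_Ebig, dotM_zero, sdpnObj]
  ring

theorem IsSquare.mul_eq_mul_of_isRankOne {T : Idx n → ℝ} (hT : IsRankOne T)
    {a b c e : Idx n} (h : IsSquare a b c e) : T a * T b = T c * T e := by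
  obtain ⟨u, hu⟩ := hT
  simp only [hu, ← Finset.prod_mul_distrib]
  refine Finset.prod_congr rfl fun i _ => ?_
  obtain ⟨hmax, hmin⟩ := h.2 i
  have key : (a i = c i ∧ b i = e i) ∨ (a i = e i ∧ b i = c i) := by
    simp only [Fin.ext_iff] at hmax hmin ⊢
    have h1 : max (a i : ℕ) (b i) = max (c i : ℕ) (e i) := by
      simpa using hmax
    have h2 : min (a i : ℕ) (b i) = min (c i : ℕ) (e i) := by
      simpa using hmin
    omega
  rcases key with ⟨h1, h2⟩ | ⟨h1, h2⟩
  · rw [h1, h2]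
  · rw [h1, h2, mul_comm]

theorem dotM_dualNMatrix_of_squares (Ω : Finset (Idx n)) (Teps : Idx n → ℝ) (c ρ : ℝ)
    (μ : Idx n → Idx n → Idx n → Idx n → ℝ) {x : Idx n → ℝ} {X : Matrix (Idx n) (Idx n) ℝ}
    (hX : X.IsSymm) (hsq : ∀ a b c e : Idx n, IsSquare a b c e → X a b = X c e) :
    dotM (dualNMatrix Ω Teps c ρ μ) (border x X) = sdpnObj Ω Teps c x X - ρ := by
  classical
  rw [dotM_dualNMatrix, sub_eq_self]
  refine Finset.sum_eq_zero fun a _ => Finset.sum_eq_zero fun b _ =>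
    Finset.sum_eq_zero fun cc _ => Finset.sum_eq_zero fun e _ => ?_
  split_ifs with h
  · rw [hX.apply a b, hX.apply cc e, hsq _ _ _ _ h]
    ring
  · rfl

theorem dualNMatrix_isHermitian (Ω : Finset (Idx n)) (Teps : Idx n → ℝ) (c ρ : ℝ)
    (μ : Idx n → Idx n → Idx n → Idx n → ℝ) : (dualNMatrix Ω Teps c ρ μ).IsHermitian := by
  have hE : (E00 (n := n)).transpose = E00 := by
    ext a b
    simp [E00, and_comm]
  rw [Matrix.IsHermitian, Matrix.conjTranspose_eq_transpose_of_trivial]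
  simp only [dualNMatrix, Ibot, Matrix.transpose_add, Matrix.transpose_sub,
    Matrix.transpose_smul, Matrix.transpose_sum, Matrix.transpose_one, hE,
    apply_ite Matrix.transpose, Matrix.transpose_zero, Ebig, Amat,
    Matrix.transpose_vecMulVec]
  congr 1
  refine Finset.sum_congr rfl fun a _ => Finset.sum_congr rfl fun b _ =>
    Finset.sum_congr rfl fun cc _ => Finset.sum_congr rfl fun e _ => ?_
  split_ifs
  · rw [add_comm (Matrix.vecMulVec (indVec b) _), add_comm (Matrix.vecMulVec (indVec e) _)]
  · rfl

/-- A symmetric matrix whose quadratic form is nonnegative on the affine chart `[1; x]` is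
positive semidefinite. -/
theorem posSemidef_of_dotM_border_nonneg {Q : Matrix (Option (Idx n)) (Option (Idx n)) ℝ}
    (hQ : Q.IsHermitian)
    (h : ∀ x : Idx n → ℝ, 0 ≤ dotM Q (border x (Matrix.vecMulVec x x))) :
    Q.PosSemidef := by
  have hform (v : Option (Idx n) → ℝ) :
      star v ⬝ᵥ (Q.mulVec v) = dotM Q (Matrix.vecMulVec v v) := by
    simp only [dotM, dotProduct, Matrix.mulVec, Matrix.vecMulVec_apply, star_trivial,
      Finset.mul_sum]
    exact Finset.sum_congr rfl fun a _ => Finset.sum_congr rfl fun b _ => by ring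
  have hchart (v : Option (Idx n) → ℝ) (hv : v none ≠ 0) :
      0 ≤ dotM Q (Matrix.vecMulVec v v) := by
    have hscale : dotM Q (Matrix.vecMulVec v v) = v none ^ 2 *
        dotM Q (border (fun α => v (some α) / v none)
          (Matrix.vecMulVec (fun α => v (some α) / v none) fun α => v (some α) / v none)) := by
      simp only [border_vecMulVec_self, dotM, Matrix.vecMulVec_apply, Finset.mul_sum]
      refine Finset.sum_congr rfl fun a _ => Finset.sum_congr rfl fun b _ => ?_
      rcases a with _ | a <;> rcases b with _ | b <;> simp <;> field_simp
    rw [hscale]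
    exact mul_nonneg (sq_nonneg _) (h _)
  refine Matrix.posSemidef_iff_dotProduct_mulVec.mpr ⟨hQ, fun v => ?_⟩
  rw [hform]
  by_cases hv : v none = 0
  · have hcont : Continuous fun t : ℝ => dotM Q (Matrix.vecMulVec
        (fun o => v o + t * Option.elim o 1 0) (fun o => v o + t * Option.elim o 1 0)) := by
      simp only [dotM, Matrix.vecMulVec_apply]
      fun_prop
    have hlim := (hcont.tendsto 0).mono_left (nhdsWithin_le_nhds (s := {0}ᶜ))
    simp only [zero_mul, add_zero] at hlim
    refine ge_of_tendsto hlim ?_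
    filter_upwards [self_mem_nhdsWithin] with t ht
    refine hchart _ ?_
    simpa [hv] using ht
  · exact hchart v hv

open Classical in
/-- Elements of `I₂ + J₂` as explicit combinations of the generators. -/
theorem exists_multipliers_of_mem {Ω : Finset (Idx n)} {That : Idx n → ℝ}
    {p : MvPolynomial (Idx n) ℝ} (hp : p ∈ I2span (↑Ω : Set (Idx n)) That ⊔ J2span n) :
    ∃ (l v : Idx n → ℝ) (μ : Idx n → Idx n → Idx n → Idx n → ℝ), ∀ x : Idx n → ℝ,
      MvPolynomial.eval x p =
        ∑ α ∈ Ω, (l α * (x α - That α) + v α * (x α ^ 2 - That α ^ 2)) +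
        ∑ a : Idx n, ∑ b : Idx n, ∑ c : Idx n, ∑ e : Idx n,
          (if IsSquare a b c e then μ a b c e * (x a * x b - x c * x e) else 0) := by
  rw [I2span, J2span, ← Submodule.span_union] at hp
  induction hp using Submodule.span_induction with
  | mem p hp =>
    rcases hp with (⟨α, hα, rfl⟩ | ⟨α, hα, rfl⟩) | ⟨a, b, c, e, hs, rfl⟩
    · refine ⟨Pi.single α 1, 0, 0, fun x => ?_⟩
      have hα' : α ∈ Ω := hα
      simp [fPoly, Pi.single_apply, hα']
    · refine ⟨0, Pi.single α 1, 0, fun x => ?_⟩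
      have hα' : α ∈ Ω := hα
      simp [gPoly, Pi.single_apply, hα']
    · refine ⟨0, 0, Pi.single a (Pi.single b (Pi.single c (Pi.single e 1))), fun x => ?_⟩
      simp only [Pi.zero_apply, zero_mul, add_zero, Finset.sum_const_zero, zero_add]
      refine Eq.symm <| (Fintype.sum_eq_single a ?_).trans <|
        (Fintype.sum_eq_single b ?_).trans <| (Fintype.sum_eq_single c ?_).trans <|
        (Fintype.sum_eq_single e ?_).trans ?_
      · intro a' ha
        simp [Pi.single_eq_of_ne ha]
      · intro b' hb
        simp [Pi.single_eq_of_ne hb]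
      · intro c' hc
        simp [Pi.single_eq_of_ne hc]
      · intro e' he
        simp [Pi.single_eq_of_ne he]
      · simp [hs]
  | zero => exact ⟨0, 0, 0, fun x => by simp⟩
  | add p q _ _ hp hq =>
    obtain ⟨l, v, μ, h⟩ := hp
    obtain ⟨l', v', μ', h'⟩ := hq
    refine ⟨l + l', v + v', μ + μ', fun x => ?_⟩
    rw [map_add, h, h', add_add_add_comm, ← Finset.sum_add_distrib]
    simp only [← Finset.sum_add_distrib, Pi.add_apply]
    congr 1
    · exact Finset.sum_congr rfl fun _ _ => by ring
    · refine Finset.sum_congr rfl fun a _ => Finset.sum_congr rfl fun b _ =>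
        Finset.sum_congr rfl fun cc _ => Finset.sum_congr rfl fun e _ => ?_
      split_ifs <;> ring
  | smul r p _ hp =>
    obtain ⟨l, v, μ, h⟩ := hp
    refine ⟨fun α => r * l α, fun α => r * v α, fun a b c e => r * μ a b c e, fun x => ?_⟩
    rw [MvPolynomial.smul_eval, h, mul_add]
    simp only [Finset.mul_sum]
    refine congrArg₂ (· + ·) ?_ ?_
    · exact Finset.sum_congr rfl fun _ _ => by ring
    · refine Finset.sum_congr rfl fun a _ => Finset.sum_congr rfl fun b _ =>
        Finset.sum_congr rfl fun cc _ => Finset.sum_congr rfl fun e _ => ?_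
      split_ifs <;> ring

/-- The bordered rank-one matrix of a rank-one tensor is feasible for (SDP-N). -/
theorem IsRankOne.sdpnFeasible {T : Idx n → ℝ} (hT : IsRankOne T) :
    SDPNFeasible T (Matrix.vecMulVec T T) where
  isSymm := Matrix.transpose_vecMulVec T T
  squares _ _ _ _ h := h.mul_eq_mul_of_isRankOne hT
  psd := by
    rw [border_vecMulVec_self]
    simpa using Matrix.posSemidef_vecMulVec_self_star (R := ℝ)
      (fun o : Option (Idx n) => Option.elim o 1 T)

theorem abs_le_supNormOn {Ω : Finset (Idx n)} (ε : Idx n → ℝ) {α : Idx n} (hα : α ∈ Ω) :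
    |ε α| ≤ supNormOn Ω ε :=
  le_ciSup (f := fun α : {a : Idx n // a ∈ Ω} => |ε (α : Idx n)|)
    (Set.finite_range _).bddAbove ⟨α, hα⟩

theorem supNormOn_nonneg (Ω : Finset (Idx n)) (ε : Idx n → ℝ) : 0 ≤ supNormOn Ω ε :=
  Real.iSup_nonneg fun _ => abs_nonneg _

end DualMatrix

/-- Under SR-propagation, given a rank-`N` Gram matrix `Q̄` certifying
tightness of (SDP-E), for every noise `ε` and all sufficiently large `C > 0` there is a
dual feasible `Q̄_c^ε ⪰ Q̄` for (dSDP-N) whose trace inner products with `𝐗̄` and with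
every optimal solution of (SDP-N) are at most `K(‖ε‖_∞ + ‖ε‖_∞²·C + 1/C)`. -/
theorem statement17 {d : ℕ} {n : Fin d → ℕ} (Ω : Finset (Idx n)) (That : Idx n → ℝ)
    (hSR : SRPropagation (↑Ω : Set (Idx n))) (hnz : ∀ α ∈ Ω, That α ≠ 0)
    (T : Idx n → ℝ) (hT : IsRankOne T) (hTm : ∀ α ∈ Ω, T α = That α)
    (huniq : ∀ T' : Idx n → ℝ, IsRankOne T' → (∀ α ∈ Ω, T' α = That α) → T' = T)
    (Qbar : Matrix (Option (Idx n)) (Option (Idx n)) ℝ)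
    (hQpsd : Qbar.PosSemidef) (hQrank : Qbar.rank = Fintype.card (Idx n))
    (hQmod : (∑ β : Idx n, (MvPolynomial.X β ^ 2 - MvPolynomial.C (T β ^ 2)))
        - gramPoly Qbar ∈ I2span (↑Ω : Set (Idx n)) That ⊔ J2span n) :
    ∃ K : ℝ, 0 < K ∧ ∀ ε : Idx n → ℝ, ∃ c₀ : ℝ, 0 < c₀ ∧ ∀ c : ℝ, c₀ ≤ c →
      ∃ Qce : Matrix (Option (Idx n)) (Option (Idx n)) ℝ,
        DualNFeasible Ω (fun α => That α + ε α) c Qce ∧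
        (Qce - Qbar).PosSemidef ∧
        dotM Qce (border T (Matrix.vecMulVec T T)) ≤
          K * (supNormOn Ω ε + supNormOn Ω ε ^ 2 * c + 1 / c) ∧
        ∀ (x : Idx n → ℝ) (X : Matrix (Idx n) (Idx n) ℝ),
          SDPNOptimal Ω (fun α => That α + ε α) c x X →
            dotM Qce (border x X) ≤
              K * (supNormOn Ω ε + supNormOn Ω ε ^ 2 * c + 1 / c) := by
  classical
  obtain ⟨l, v, μ, hcert⟩ := exists_multipliers_of_mem hQmod
  have hTsq (a b c e : Idx n) (h : IsSquare a b c e) : T a * T b = T c * T e :=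
    h.mul_eq_mul_of_isRankOne hT
  have hgram (x : Idx n → ℝ) : dotM Qbar (border x (Matrix.vecMulVec x x)) =
      ∑ β, (x β ^ 2 - T β ^ 2) -
        (∑ α ∈ Ω, (l α * (x α - T α) + v α * (x α ^ 2 - T α ^ 2)) +
        ∑ a : Idx n, ∑ b : Idx n, ∑ c : Idx n, ∑ e : Idx n,
          (if IsSquare a b c e then μ a b c e * (x a * x b - x c * x e) else 0)) := by
    have h := hcert x
    rw [map_sub, ← dotM_border_vecMulVec_self] at h
    have h' : ∑ α ∈ Ω, (l α * (x α - T α) + v α * (x α ^ 2 - T α ^ 2)) =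
        ∑ α ∈ Ω, (l α * (x α - That α) + v α * (x α ^ 2 - That α ^ 2)) :=
      Finset.sum_congr rfl fun α hα => by rw [hTm α hα]
    rw [h', ← h]
    simp
  have hgramT : dotM Qbar (border T (Matrix.vecMulVec T T)) = 0 := by
    rw [hgram, Finset.sum_eq_zero (s := Ω) (fun α _ => by ring),
      Finset.sum_eq_zero (fun β _ => sub_self _), zero_add, zero_sub, neg_eq_zero]
    refine Finset.sum_eq_zero fun a _ => Finset.sum_eq_zero fun b _ =>
      Finset.sum_eq_zero fun cc _ => Finset.sum_eq_zero fun e _ => ?_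
    split_ifs with h
    · rw [hTsq _ _ _ _ h, sub_self, mul_zero]
    · rfl
  -- the linear coefficients of the generators at the point `T`
  set κ : Idx n → ℝ := fun α => l α + 2 * v α * T α with hκ
  refine ⟨1 + ∑ α ∈ Ω, (κ α ^ 2 + 4), by positivity, fun ε =>
    ⟨1 + 2 * ∑ α ∈ Ω, |v α|, by positivity, fun c hc => ?_⟩⟩
  have hv (α : Idx n) (hα : α ∈ Ω) : |v α| ≤ c / 2 - 1 / 2 := by
    have := Finset.single_le_sum (f := fun α => |v α|) (fun _ _ => abs_nonneg _) hα
    linarith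
  have hc1 : 1 ≤ c := by
    have : 0 ≤ ∑ α ∈ Ω, |v α| := Finset.sum_nonneg fun _ _ => abs_nonneg _
    linarith
  have hc0 : 0 < c := by linarith
  have hcv (α : Idx n) (hα : α ∈ Ω) : c / 2 ≤ c + v α := by
    have := neg_abs_le (v α)
    have := hv α hα
    linarith
  -- the deviation from `T α` at which the `α`-th summand of the difference is minimal
  set y : Idx n → ℝ := fun α => (2 * c * ε α - κ α) / (2 * (c + v α)) with hy
  set ρ : ℝ := ∑ β, T β ^ 2 + ∑ α ∈ Ω, (c * ε α ^ 2 - (c + v α) * y α ^ 2) with hρ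
  set Q := dualNMatrix Ω (fun α => That α + ε α) c ρ μ with hQ
  have hdiff (x : Idx n → ℝ) : dotM (Q - Qbar) (border x (Matrix.vecMulVec x x)) =
      ∑ α ∈ Ω, (c + v α) * (x α - T α - y α) ^ 2 := by
    have hJ : ∑ a : Idx n, ∑ b : Idx n, ∑ cc : Idx n, ∑ e : Idx n,
          (if IsSquare a b cc e then
            (μ a b cc e / 2) * ((x a * x b + x b * x a) - (x cc * x e + x e * x cc)) else 0) =
        ∑ a : Idx n, ∑ b : Idx n, ∑ c : Idx n, ∑ e : Idx n,
          (if IsSquare a b c e then μ a b c e * (x a * x b - x c * x e) else 0) := by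
      refine Finset.sum_congr rfl fun a _ => Finset.sum_congr rfl fun b _ =>
        Finset.sum_congr rfl fun cc _ => Finset.sum_congr rfl fun e _ => ?_
      split_ifs <;> ring
    have htr : Matrix.trace (Matrix.vecMulVec x x) = ∑ β, x β ^ 2 := by
      simp [Matrix.trace, Matrix.vecMulVec_apply, sq]
    have hsummand : ∑ α ∈ Ω, (c + v α) * (x α - T α - y α) ^ 2 =
        c * ∑ α ∈ Ω, (x α * x α - 2 * (That α + ε α) * x α + (That α + ε α) ^ 2) +
        ∑ α ∈ Ω, (l α * (x α - T α) + v α * (x α ^ 2 - T α ^ 2)) -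
        ∑ α ∈ Ω, (c * ε α ^ 2 - (c + v α) * y α ^ 2) := by
      rw [Finset.mul_sum, ← Finset.sum_add_distrib, ← Finset.sum_sub_distrib]
      refine Finset.sum_congr rfl fun α hα => ?_
      have hne : c + v α ≠ 0 := by linarith [hcv α hα]
      have hyα : (c + v α) * y α = c * ε α - κ α / 2 := by
        simp only [hy]
        field_simp
      rw [← hTm α hα]
      simp only [hκ] at hyα
      linear_combination (-2 * (x α - T α)) * hyα
    rw [dotM_sub, hgram, hQ, dotM_dualNMatrix]
    simp only [sdpnObj, Matrix.vecMulVec_apply, htr]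
    rw [hJ, hsummand, hρ, Finset.sum_sub_distrib (fun β => x β ^ 2) (fun β => T β ^ 2)]
    ring
  have hdiffPSD : (Q - Qbar).PosSemidef := by
    refine posSemidef_of_dotM_border_nonneg
      ((dualNMatrix_isHermitian _ _ _ _ _).sub hQpsd.isHermitian) fun x => ?_
    rw [hdiff]
    exact Finset.sum_nonneg fun α hα =>
      mul_nonneg (by linarith [hcv α hα]) (sq_nonneg _)
  have hQPSD : Q.PosSemidef := by
    simpa using hdiffPSD.add hQpsd
  have hvalue : dotM Q (border T (Matrix.vecMulVec T T)) = ∑ α ∈ Ω, (c + v α) * y α ^ 2 := by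
    have h := hdiff T
    rw [dotM_sub, hgramT, sub_zero] at h
    simpa using h
  have hbound : dotM Q (border T (Matrix.vecMulVec T T)) ≤
      (1 + ∑ α ∈ Ω, (κ α ^ 2 + 4)) * (supNormOn Ω ε + supNormOn Ω ε ^ 2 * c + 1 / c) := by
    have hs := supNormOn_nonneg Ω ε
    have hw : 0 ≤ supNormOn Ω ε + supNormOn Ω ε ^ 2 * c + 1 / c := by positivity
    rw [hvalue, add_mul, one_mul, Finset.sum_mul]
    refine le_trans (Finset.sum_le_sum fun α hα => ?_) (le_add_of_nonneg_left hw)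
    have hpos : 0 < c + v α := by linarith [hcv α hα]
    have hε : ε α ^ 2 ≤ supNormOn Ω ε ^ 2 := by
      rw [← sq_abs]
      exact pow_le_pow_left₀ (abs_nonneg _) (abs_le_supNormOn ε hα) 2
    calc (c + v α) * y α ^ 2 = (2 * c * ε α - κ α) ^ 2 / (4 * (c + v α)) := by
          simp only [hy]
          field_simp
          ring
      _ ≤ (2 * c * ε α - κ α) ^ 2 / (2 * c) := by
          exact div_le_div_of_nonneg_left (sq_nonneg _) (by positivity) (by linarith [hcv α hα])
      _ ≤ (2 * (2 * c * ε α) ^ 2 + 2 * κ α ^ 2) / (2 * c) := by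
          gcongr
          nlinarith [sq_nonneg (2 * c * ε α + κ α)]
      _ = 4 * (ε α ^ 2 * c) + κ α ^ 2 * (1 / c) := by
          field_simp
          ring
      _ ≤ 4 * (supNormOn Ω ε ^ 2 * c) + κ α ^ 2 * (1 / c) := by
          gcongr
      _ ≤ (κ α ^ 2 + 4) * (supNormOn Ω ε + supNormOn Ω ε ^ 2 * c + 1 / c) := by
          have h1 : 0 ≤ κ α ^ 2 * supNormOn Ω ε := by positivity
          have h2 : 0 ≤ κ α ^ 2 * (supNormOn Ω ε ^ 2 * c) := by positivity
          have h3 : 0 ≤ 1 / c := by positivity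
          linarith
  refine ⟨Q, ⟨hQPSD, ρ, μ, rfl⟩, hdiffPSD, hbound, fun x X hX => le_trans ?_ hbound⟩
  have hTfeas := hT.sdpnFeasible
  rw [hQ, dotM_dualNMatrix_of_squares _ _ _ _ _ hX.1.isSymm hX.1.squares,
    dotM_dualNMatrix_of_squares _ _ _ _ _ hTfeas.isSymm hTfeas.squares]
  exact sub_le_sub_right (hX.2 _ _ hTfeas) ρ

end RankOneTC
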